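/- arXiv:1409.4067 — 2 statements merged into one kernel-verified Lean document; each statement's English description precedes it below -/
import Mathlib

section
/- Let ω, ω_X, ω_C, γ, g be real numbers with γ ≠ 0, g > 0, ω < min(ω_X, ω_C), and 0 < ϖ_X·ϖ_C < γ² (band 1.1). Then there exist functions φ_X, φ_C : ℝ → ℝ, with φ_X continuously differentiable and φ_C twice continuously differentiable, satisfying the stationary polariton envelope equations at every x ∈ ℝ, such that φ_X and φ_C are odd, monotone, and bounded, and φ_X(x)² tends to (ϖ_X − γ²/ϖ_C)/g as x → +∞ and as x → −∞. -/
open Filter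

/-- The autonomous equation `θ' = k θ` with `k` continuous, even, positive and bounded has an odd
solution on the whole line which runs from `-∞` to `+∞`. -/
theorem exists_odd_global_solution {k : ℝ → ℝ} {M : ℝ} (hk : Continuous k)
    (hpos : ∀ s, 0 < k s) (hM : ∀ s, k s ≤ M) (heven : ∀ s, k (-s) = k s) :
    ∃ θ : ℝ → ℝ, (∀ x, HasDerivAt θ (k (θ x)) x) ∧ (∀ x, θ (-x) = -θ x) ∧
      Tendsto θ atTop atTop ∧ Tendsto θ atBot atBot := by
  have hM0 : 0 < M := (hpos 0).trans_le (hM 0)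
  have hc : Continuous fun s => (k s)⁻¹ := hk.inv₀ fun s => (hpos s).ne'
  set X : ℝ → ℝ := fun t => ∫ s in (0 : ℝ)..t, (k s)⁻¹ with hX
  have hd : ∀ t, HasDerivAt X (k t)⁻¹ t := fun t =>
    intervalIntegral.integral_hasDerivAt_right (hc.intervalIntegrable _ _)
      (hc.stronglyMeasurableAtFilter _ _) hc.continuousAt
  have hmono : StrictMono X := strictMono_of_hasDerivAt_pos hd fun t => inv_pos.2 (hpos t)
  have hodd : ∀ t, X (-t) = -X t := by
    intro t
    have h := intervalIntegral.integral_comp_neg (a := 0) (b := t) fun s => (k s)⁻¹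
    simp only [heven, neg_zero] at h
    simp only [hX]
    rw [h, intervalIntegral.integral_symm]
  have hX0 : X 0 = 0 := by simp [hX]
  have hlin : Monotone fun t => X t - M⁻¹ * t := by
    have hd' : ∀ t, HasDerivAt (fun t => X t - M⁻¹ * t) ((k t)⁻¹ - M⁻¹ * 1) t := fun t =>
      (hd t).sub ((hasDerivAt_id t).const_mul _)
    refine monotone_of_deriv_nonneg (fun t => (hd' t).differentiableAt) fun t => ?_
    rw [(hd' t).deriv, mul_one, sub_nonneg]
    exact inv_anti₀ (hpos t) (hM t)
  have htop : Tendsto X atTop atTop := by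
    refine tendsto_atTop_mono' _ ?_ (tendsto_id.const_mul_atTop (inv_pos.2 hM0))
    filter_upwards [eventually_ge_atTop 0] with t ht
    have := hlin ht
    simp only [hX0] at this
    simp only [id]
    linarith
  have hbot : Tendsto X atBot atBot := by
    refine tendsto_atBot_mono' _ ?_ (tendsto_id.const_mul_atBot (inv_pos.2 hM0))
    filter_upwards [eventually_le_atBot 0] with t ht
    have := hlin ht
    simp only [hX0] at this
    simp only [id]
    linarith
  have hcont : Continuous X := continuous_iff_continuousAt.2 fun t => (hd t).continuousAt
  let e : ℝ ≃o ℝ := hmono.orderIsoOfSurjective X (hcont.surjective htop hbot)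
  have he : ∀ y, X (e.symm y) = y := fun y => e.apply_symm_apply y
  refine ⟨e.symm, fun x => ?_, fun x => ?_, e.symm.tendsto_atTop, e.symm.tendsto_atBot⟩
  · have := (hd (e.symm x)).of_local_left_inverse e.symm.continuous.continuousAt
      (inv_ne_zero (hpos _).ne') (Eventually.of_forall he)
    rwa [inv_inv] at this
  · apply hmono.injective
    rw [he, hodd, he]

theorem Real.one_sub_tanh_sq (x : ℝ) : 1 - Real.tanh x ^ 2 = (Real.cosh x ^ 2)⁻¹ := by
  have hc := (Real.cosh_pos x).ne'
  rw [Real.tanh_eq_sinh_div_cosh]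
  field_simp
  linarith [Real.cosh_sq x]

theorem Real.hasDerivAt_tanh (x : ℝ) : HasDerivAt Real.tanh (1 - Real.tanh x ^ 2) x := by
  have hc := (Real.cosh_pos x).ne'
  have h := (Real.hasDerivAt_sinh x).div (Real.hasDerivAt_cosh x) hc
  have hfun : Real.tanh = Real.sinh / Real.cosh := funext Real.tanh_eq_sinh_div_cosh
  rw [hfun]
  refine h.congr_deriv ?_
  rw [Pi.div_apply]
  field_simp

theorem Real.tendsto_cosh_atTop : Tendsto Real.cosh atTop atTop := by
  refine tendsto_atTop_mono (fun x => ?_) (Real.tendsto_exp_atTop.atTop_div_const two_pos)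
  rw [Real.cosh_eq]
  linarith [Real.exp_pos (-x)]

theorem Real.tendsto_cosh_atBot : Tendsto Real.cosh atBot atTop := by
  simpa [Function.comp_def] using Real.tendsto_cosh_atTop.comp tendsto_neg_atBot_atTop

theorem Real.tendsto_tanh_sq {α : Type*} {l : Filter α} {f : α → ℝ}
    (hf : Tendsto (fun x => Real.cosh (f x)) l atTop) :
    Tendsto (fun x => Real.tanh (f x) ^ 2) l (nhds 1) := by
  have h := (tendsto_inv_atTop_zero.comp
    ((tendsto_pow_atTop two_ne_zero).comp hf)).const_sub (1 : ℝ)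
  rw [sub_zero] at h
  refine h.congr fun x => ?_
  simp only [Function.comp_apply]
  linarith [Real.one_sub_tanh_sq (f x)]

/-- The equation `u' = (U² - u²) h(u)` with `h` continuous, even and positive has an odd solution
connecting the equilibria `-U` and `U`. -/
theorem exists_odd_kink {h : ℝ → ℝ} {U : ℝ} (hU : 0 < U) (hh : Continuous h)
    (hpos : ∀ s, 0 < h s) (heven : ∀ s, h (-s) = h s) :
    ∃ u : ℝ → ℝ, (∀ x, HasDerivAt u ((U ^ 2 - u x ^ 2) * h (u x)) x) ∧ (∀ x, u (-x) = -u x) ∧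
      (∀ x, u x ^ 2 < U ^ 2) ∧
      Tendsto (fun x => u x ^ 2) atTop (nhds (U ^ 2)) ∧
      Tendsto (fun x => u x ^ 2) atBot (nhds (U ^ 2)) := by
  have htanh : ∀ s, Real.tanh s ^ 2 < 1 := fun s => by
    have : 0 < (Real.cosh s ^ 2)⁻¹ := by have := Real.cosh_pos s; positivity
    linarith [Real.one_sub_tanh_sq s]
  obtain ⟨M, hM⟩ := (isCompact_Icc (a := -U) (b := U)).bddAbove_image hh.continuousOn
  have hbound : ∀ s, U * h (U * Real.tanh s) ≤ U * M := by
    intro s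
    have h1 := abs_le.1 (abs_le_one_iff_mul_self_le_one.2 (by nlinarith [htanh s]) :
      |Real.tanh s| ≤ 1)
    exact mul_le_mul_of_nonneg_left
      (hM ⟨_, ⟨by nlinarith [h1.1], by nlinarith [h1.2]⟩, rfl⟩) hU.le
  have hct : Continuous Real.tanh :=
    continuous_iff_continuousAt.2 fun t => (Real.hasDerivAt_tanh t).continuousAt
  obtain ⟨θ, hθ, hodd, htop, hbot⟩ := exists_odd_global_solution
    (k := fun s => U * h (U * Real.tanh s)) (by fun_prop) (fun s => mul_pos hU (hpos _)) hbound
    (fun s => by simp only [Real.tanh_neg, mul_neg, heven])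
  have hlim : ∀ {l : Filter ℝ}, Tendsto (fun x => Real.cosh (θ x)) l atTop →
      Tendsto (fun x => (U * Real.tanh (θ x)) ^ 2) l (nhds (U ^ 2)) := fun hl => by
    simpa [mul_pow] using (Real.tendsto_tanh_sq hl).const_mul (U ^ 2)
  refine ⟨fun x => U * Real.tanh (θ x), fun x => ?_, fun x => ?_, fun x => ?_,
    hlim (Real.tendsto_cosh_atTop.comp htop), hlim (Real.tendsto_cosh_atBot.comp hbot)⟩
  · exact (((Real.hasDerivAt_tanh (θ x)).comp x (hθ x)).const_mul U).congr_deriv (by ring)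
  · simp only [hodd, Real.tanh_neg, mul_neg]
  · rw [mul_pow]
    nlinarith [htanh (θ x), pow_pos hU 2]

/-- Band 1.1: existence of dark solitons for `g > 0` and `ω < min(ωX, ωC)`,
`0 < ϖX·ϖC < γ²`: antisymmetric, monotonic, bounded envelopes with far-field
amplitude `(ϖX − γ²/ϖC)/g`. -/
theorem dark_soliton_band_1_1
    (ω ωX ωC γ g : ℝ) (hγ : γ ≠ 0) (hg : 0 < g)
    (hω : ω < min ωX ωC)
    (hband₁ : 0 < (ω - ωX) * (ω - ωC)) (hband₂ : (ω - ωX) * (ω - ωC) < γ ^ 2) :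
    ∃ φX φC : ℝ → ℝ,
      ContDiff ℝ 1 φX ∧ ContDiff ℝ 2 φC ∧
      (∀ x : ℝ, (g * φX x ^ 2 - (ω - ωX)) * φX x + γ * φC x = 0) ∧
      (∀ x : ℝ, -(1/2) * deriv (deriv φC) x - (ω - ωC) * φC x + γ * φX x = 0) ∧
      (∀ x : ℝ, φX (-x) = -φX x) ∧ (∀ x : ℝ, φC (-x) = -φC x) ∧
      (Monotone φX ∨ Antitone φX) ∧ (Monotone φC ∨ Antitone φC) ∧
      (∃ M : ℝ, ∀ x : ℝ, |φX x| ≤ M) ∧ (∃ M : ℝ, ∀ x : ℝ, |φC x| ≤ M) ∧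
      Tendsto (fun x => φX x ^ 2) atTop (nhds (((ω - ωX) - γ ^ 2 / (ω - ωC)) / g)) ∧
      Tendsto (fun x => φX x ^ 2) atBot (nhds (((ω - ωX) - γ ^ 2 / (ω - ωC)) / g)) := by
  obtain ⟨hωX, hωC⟩ := lt_min_iff.1 hω
  set a := ωX - ω with ha
  set b := ωC - ω with hb
  have hX : ω - ωX = -a := by ring
  have hC : ω - ωC = -b := by ring
  have ha0 : 0 < a := sub_pos.2 hωX
  have hb0 : 0 < b := sub_pos.2 hωC
  rw [hX, hC] at hband₂ ⊢
  have hlimit : (-a - γ ^ 2 / -b) / g = (γ ^ 2 - a * b) / (b * g) := by field_simp; ring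
  rw [hlimit]
  set T := (γ ^ 2 - a * b) / (b * g) with hT
  have hT0 : 0 < T := div_pos (by linarith) (by positivity)
  have hTeq : b * g * T = γ ^ 2 - a * b := by rw [hT]; field_simp
  set A := (g * T + a) / 2 with hA
  have hA0 : 0 < A := by positivity
  set P := √(2 * b * g)
  have hP0 : 0 < P := by positivity
  have hP2 : P ^ 2 = 2 * b * g := Real.sq_sqrt (by positivity)
  clear_value P A T b a
  have hAs : ∀ s : ℝ, 0 < A + g * s ^ 2 := fun s => by positivity
  have hQs : ∀ s : ℝ, 0 < 3 * g * s ^ 2 + a := fun s => by positivity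
  have hU2 : √T ^ 2 = T := Real.sq_sqrt hT0.le
  obtain ⟨u, hu, hodd, hlt, htop, hbot⟩ := exists_odd_kink (U := √T)
    (h := fun s => P * √(A + g * s ^ 2) / (3 * g * s ^ 2 + a)) (by positivity)
    (Continuous.div (by fun_prop) (by fun_prop) fun s => (hQs s).ne')
    (fun s => by have := hAs s; have := hQs s; positivity) (fun s => by simp only [neg_sq])
  simp only [hU2] at hu hlt htop hbot
  have hcu : Continuous u := continuous_iff_continuousAt.2 fun x => (hu x).continuousAt
  have hdu : Differentiable ℝ u := fun x => (hu x).differentiableAt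
  have hmono : Monotone u := monotone_of_deriv_nonneg hdu fun x => by
    rw [(hu x).deriv]
    have := hAs (u x)
    have := hQs (u x)
    have := sub_pos.2 (hlt x)
    positivity
  have hu1 : ContDiff ℝ 1 u := by
    refine contDiff_one_iff_deriv.2 ⟨hdu, ?_⟩
    rw [funext fun x => (hu x).deriv]
    exact (by fun_prop : Continuous fun x => T - u x ^ 2).mul
      (Continuous.div (by fun_prop) (by fun_prop) fun x => (hQs _).ne')
  -- The photonic field is `-(g u³ + a u)/γ`; its derivative is `-v/γ`.
  set v : ℝ → ℝ := fun x => P * ((T - u x ^ 2) * √(A + g * u x ^ 2)) with hv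
  have hw : ∀ x, HasDerivAt (fun x => -(g * u x ^ 3 + a * u x) / γ) (-v x / γ) x := by
    intro x
    refine ((((hu x).pow 3).const_mul g).add
      ((hu x).const_mul a)).neg.div_const γ |>.congr_deriv ?_
    simp only [hv]
    have := (hQs (u x)).ne'
    field_simp
    push_cast
    ring
  have hv1 : ContDiff ℝ 1 v :=
    contDiff_const.mul ((contDiff_const.sub (hu1.pow 2)).mul
      ((contDiff_const.add (contDiff_const.mul (hu1.pow 2))).sqrt fun x => (hAs _).ne'))
  have hv' : ∀ x, HasDerivAt v (-(2 * b * g) * (u x * (T - u x ^ 2))) x := by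
    intro x
    have hs := ((((hu x).pow 2).const_mul g).const_add A).sqrt (hAs (u x)).ne'
    refine ((((hu x).pow 2).const_sub T).mul hs).const_mul P |>.congr_deriv ?_
    have hq := (hQs (u x)).ne'
    have hr : √(A + g * u x ^ 2) ≠ 0 := (Real.sqrt_pos.2 (hAs (u x))).ne'
    have hr2 : √(A + g * u x ^ 2) ^ 2 = A + g * u x ^ 2 := Real.sq_sqrt (hAs (u x)).le
    simp only [Pi.pow_apply, ← hP2]
    generalize √(A + g * u x ^ 2) = r at hr hr2 ⊢
    field_simp
    rw [hr2, hA]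
    push_cast
    ring
  have hdw : deriv (fun x => -(g * u x ^ 3 + a * u x) / γ) = fun x => -v x / γ :=
    funext fun x => (hw x).deriv
  have hwmono : Monotone fun x => g * u x ^ 3 + a * u x := fun x y hxy => by
    have h3 : u x ^ 3 ≤ u y ^ 3 := (Odd.strictMono_pow (by decide)).monotone (hmono hxy)
    have h1 := hmono hxy
    dsimp only
    gcongr
  have hbd : ∀ x, |u x| ≤ √T := fun x => Real.abs_le_sqrt (hlt x).le
  refine ⟨u, fun x => -(g * u x ^ 3 + a * u x) / γ, hu1, ?_, fun x => ?_, fun x => ?_, hodd,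
    fun x => ?_, Or.inl hmono, ?_, ⟨_, hbd⟩, ⟨(g * √T ^ 3 + a * √T) / |γ|, fun x => ?_⟩,
    htop, hbot⟩
  · rw [show (2 : WithTop ℕ∞) = 1 + 1 by norm_num, contDiff_succ_iff_deriv, hdw]
    exact ⟨fun x => (hw x).differentiableAt, by simp, hv1.neg.div_const γ⟩
  · field_simp
    ring
  · have hdd : HasDerivAt (fun x => -v x / γ) _ x := (hv' x).neg.div_const γ
    rw [hdw, hdd.deriv]
    field_simp
    linear_combination (-u x) * hTeq
  · simp only [hodd]
    ring
  · rcases hγ.lt_or_gt with h | h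
    · exact Or.inl fun x y hxy => div_le_div_of_nonpos_of_le h.le (neg_le_neg (hwmono hxy))
    · exact Or.inr fun x y hxy => div_le_div_of_nonneg_right (neg_le_neg (hwmono hxy)) h.le
  · rw [abs_div, abs_neg]
    gcongr
    refine (abs_add_le _ _).trans ?_
    rw [abs_mul, abs_mul, abs_pow, abs_of_pos hg, abs_of_pos ha0]
    gcongr <;> exact hbd x
end

section
/- Let ω, ω_X, ω_C, γ, g be real numbers with γ ≠ 0, g < 0, ω < min(ω_X, ω_C), and γ² < ϖ_X·ϖ_C < (9/8)·γ² (band 2.1). Then there exist functions φ_X, φ_C : ℝ → ℝ, with φ_X continuously differentiable and φ_C twice continuously differentiable, satisfying the stationary polariton envelope equations at every x ∈ ℝ, such that φ_X and φ_C are even and bounded, φ_X(x) → 0 and φ_C(x) → 0 as x → +∞ and as x → −∞, and the supremum over x ∈ ℝ of |g|·φ_X(x)² is attained and equals −ϖ_X + (γ²/ϖ_C)·(3/4 + √(9/16 − ϖ_X·ϖ_C/(2γ²))). -/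
open Filter

/-- The autonomous equation `τ' = 1 / h(τ)`, `τ 0 = 0`, with `h` even and bounded below by a positive
constant, has a global odd solution, which tends to infinity. -/
lemma exists_odd_solution_of_even {h : ℝ → ℝ} {m : ℝ} (hm : 0 < m) (hh : ContDiff ℝ 1 h)
    (hmh : ∀ t, m ≤ h t) (heven : ∀ t, h (-t) = h t) :
    ∃ τ : ℝ → ℝ, ContDiff ℝ 2 τ ∧ (∀ x, HasDerivAt τ (h (τ x))⁻¹ x) ∧ (∀ x, τ (-x) = -τ x) ∧
      Tendsto τ atTop atTop := by
  have hpos : ∀ t, 0 < h t := fun t => hm.trans_le (hmh t)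
  have hcont : Continuous h := hh.continuous
  set X : ℝ → ℝ := fun t => ∫ r in (0 : ℝ)..t, h r with hX
  have hXd : ∀ t, HasDerivAt X (h t) t := fun t => hcont.integral_hasStrictDerivAt 0 t |>.hasDerivAt
  have hXc : Continuous X := continuous_iff_continuousAt.2 fun t => (hXd t).continuousAt
  have hXmono : StrictMono X := strictMono_of_hasDerivAt_pos hXd hpos
  have hXodd : ∀ t, X (-t) = -X t := by
    intro t
    have h1 := intervalIntegral.integral_comp_neg (a := 0) (b := t) h
    simp only [heven, neg_zero] at h1
    simp only [hX]
    rw [h1, intervalIntegral.integral_symm]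
  have hXtop : Tendsto X atTop atTop := by
    refine tendsto_atTop_mono' atTop ?_ (tendsto_id.const_mul_atTop hm)
    filter_upwards [eventually_ge_atTop 0] with t ht
    have := intervalIntegral.integral_mono_on (μ := MeasureTheory.volume) ht
      (continuous_const.intervalIntegrable 0 t) (hcont.intervalIntegrable 0 t)
      (fun r _ => hmh r)
    simpa [hX, mul_comm] using this
  have hXbot : Tendsto X atBot atBot := by
    have : X = fun t => -X (-t) := by ext t; rw [hXodd, neg_neg]
    rw [this]
    exact tendsto_neg_atTop_atBot.comp (hXtop.comp tendsto_neg_atBot_atTop)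
  let e : ℝ ≃o ℝ := hXmono.orderIsoOfSurjective X (hXc.surjective hXtop hXbot)
  have hXe : ∀ x, X (e.symm x) = x := fun x => e.apply_symm_apply x
  have hd : ∀ x, HasDerivAt e.symm (h (e.symm x))⁻¹ x := fun x =>
    (hXd _).of_local_left_inverse e.symm.continuous.continuousAt (hpos _).ne'
      (Eventually.of_forall hXe)
  have hderiv : deriv e.symm = fun x => (h (e.symm x))⁻¹ := funext fun x => (hd x).deriv
  have hdiff : Differentiable ℝ e.symm := fun x => (hd x).differentiableAt
  have h1 : ContDiff ℝ 1 e.symm := by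
    rw [contDiff_one_iff_deriv, hderiv]
    exact ⟨hdiff, (hcont.comp e.symm.continuous).inv₀ fun x => (hpos _).ne'⟩
  refine ⟨e.symm, ?_, hd, ?_, e.symm.tendsto_atTop⟩
  · rw [show (2 : WithTop ℕ∞) = 1 + 1 by norm_num, contDiff_succ_iff_deriv, hderiv]
    exact ⟨hdiff, by simp, (hh.comp h1).inv fun x => (hpos _).ne'⟩
  · intro x
    apply hXmono.injective
    rw [hXodd, hXe, hXe]

/-- The even homoclinic solution of `((a - u²) u)'' = 2 (c (a - u²) - k) u`, where `s₁ < s₂` are the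
roots of `c (a - s)² - k a + (3/2) k s`; its square has maximum `s₁`. -/
lemma exists_homoclinic {a c k s₁ s₂ : ℝ} (hc : 0 < c) (hs₁ : 0 < s₁) (hs : s₁ < s₂)
    (hs₁a : 3 * s₁ < a) (hsum : c * (s₁ + s₂) = 2 * a * c - 3 / 2 * k)
    (hprod : c * (s₁ * s₂) = c * a ^ 2 - k * a) :
    ∃ u : ℝ → ℝ, ContDiff ℝ 2 u ∧ (∀ x, u (-x) = u x) ∧ u 0 ^ 2 = s₁ ∧ (∀ x, u x ^ 2 ≤ s₁) ∧
      Tendsto u atTop (nhds 0) ∧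
      ∀ x, deriv (deriv fun y => (a - u y ^ 2) * u y) x = 2 * (c * (a - u x ^ 2) - k) * u x := by
  have hle : ∀ t, s₁ / Real.cosh t ^ 2 ≤ s₁ := fun t =>
    div_le_self hs₁.le (one_le_pow₀ (Real.one_le_cosh t))
  have hge : ∀ t, 0 ≤ s₁ / Real.cosh t ^ 2 := fun t => by positivity
  set Q : ℝ → ℝ := fun t => 2 * c * s₁ * (s₂ - s₁ / Real.cosh t ^ 2) with hQ
  have hQpos : ∀ t, 0 < Q t := fun t =>
    mul_pos (by positivity) (by linarith [hle t])
  have hsC : ContDiff ℝ 2 fun t => s₁ / Real.cosh t ^ 2 :=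
    contDiff_const.div (Real.contDiff_cosh.pow 2) fun t => (pow_pos (Real.cosh_pos t) 2).ne'
  have hQC : ContDiff ℝ 2 Q := contDiff_const.mul (contDiff_const.sub hsC)
  have hRC : ContDiff ℝ 2 fun t => √(Q t) := hQC.sqrt fun t => (hQpos t).ne'
  have hRpos : ∀ t, 0 < √(Q t) := fun t => Real.sqrt_pos.2 (hQpos t)
  set h : ℝ → ℝ := fun t => (a - 3 * (s₁ / Real.cosh t ^ 2)) / √(Q t) with hh
  have hhC : ContDiff ℝ 2 h :=
    (contDiff_const.sub (contDiff_const.mul hsC)).div hRC fun t => (hRpos t).ne'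
  have hs₂ : 0 < s₂ := hs₁.trans hs
  have hm : 0 < (a - 3 * s₁) / √(2 * c * s₁ * s₂) :=
    div_pos (by linarith) (Real.sqrt_pos.2 (by positivity))
  have hmh : ∀ t, (a - 3 * s₁) / √(2 * c * s₁ * s₂) ≤ h t := by
    intro t
    refine div_le_div₀ ?_ ?_ (hRpos t) (Real.sqrt_le_sqrt ?_)
    · linarith [hle t]
    · linarith [hle t]
    · exact mul_le_mul_of_nonneg_left (by linarith [hge t]) (by positivity)
  obtain ⟨τ, hτC, hτd, hτodd, hτtop⟩ := exists_odd_solution_of_even hm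
    (hhC.of_le (by norm_num)) hmh (fun t => by simp [hh, hQ, Real.cosh_neg])
  have hτ0 : τ 0 = 0 := by
    have := hτodd 0
    rw [neg_zero] at this
    linarith
  set u : ℝ → ℝ := fun x => √s₁ / Real.cosh (τ x) with hu
  have husq : ∀ x, u x ^ 2 = s₁ / Real.cosh (τ x) ^ 2 := fun x => by
    simp only [hu, div_pow, Real.sq_sqrt hs₁.le]
  have hud : ∀ x, HasDerivAt u
      (-(u x * (Real.sinh (τ x) / Real.cosh (τ x)) * (h (τ x))⁻¹)) x := by
    intro x
    have hC := (Real.cosh_pos (τ x)).ne'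
    refine ((hasDerivAt_const x (√s₁)).div (hτd x).cosh hC).congr_deriv ?_
    simp only [hu]
    field_simp
    ring
  have hupos : ∀ x, 0 < a - 3 * u x ^ 2 := fun x => by
    rw [husq]; linarith [hle (τ x)]
  have hR : ∀ x, (a - 3 * u x ^ 2) * (h (τ x))⁻¹ = √(Q (τ x)) := by
    intro x
    have h1 := (hupos x).ne'
    have h2 := (hRpos (τ x)).ne'
    simp only [hh, ← husq]
    field_simp
  have hwd : ∀ x, HasDerivAt (fun y => (a - u y ^ 2) * u y)
      (-(u x * (Real.sinh (τ x) / Real.cosh (τ x)) * √(Q (τ x)))) x := by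
    intro x
    refine ((((hud x).pow 2).const_sub a).mul (hud x)).congr_deriv ?_
    rw [← hR]
    simp only [Pi.pow_apply]
    push_cast
    ring
  refine ⟨u, ?_, ?_, ?_, ?_, ?_, ?_⟩
  · exact contDiff_const.div (Real.contDiff_cosh.comp hτC) fun x => (Real.cosh_pos _).ne'
  · intro x; simp only [hu, hτodd, Real.cosh_neg]
  · rw [husq, hτ0]; simp
  · intro x; rw [husq]; exact hle _
  · have hcosh : Tendsto Real.cosh atTop atTop := by
      refine tendsto_atTop_mono' atTop ?_ tendsto_id
      filter_upwards [eventually_ge_atTop 0] with t ht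
      exact (Real.self_le_sinh_iff.2 ht).trans (Real.sinh_lt_cosh t).le
    exact (hcosh.comp hτtop).const_div_atTop _
  · intro x
    rw [show (deriv fun y => (a - u y ^ 2) * u y) = _ from funext fun x => (hwd x).deriv]
    have hC := (Real.cosh_pos (τ x)).ne'
    have hQd : HasDerivAt (fun y => Q (τ y)) (4 * c * s₁ * u x ^ 2 *
        (Real.sinh (τ x) / Real.cosh (τ x)) * (h (τ x))⁻¹) x := by
      have : (fun y => Q (τ y)) = fun y => 2 * c * s₁ * (s₂ - u y ^ 2) := by
        ext y; simp only [hQ, husq]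
      rw [this]
      refine ((((hud x).pow 2).const_sub s₂).const_mul (2 * c * s₁)).congr_deriv ?_
      push_cast
      ring
    have hTd : HasDerivAt (fun y => Real.sinh (τ y) / Real.cosh (τ y))
        ((1 - (Real.sinh (τ x) / Real.cosh (τ x)) ^ 2) * (h (τ x))⁻¹) x := by
      refine ((hτd x).sinh.div (hτd x).cosh hC).congr_deriv ?_
      field_simp
    refine (((hud x).mul hTd).mul (hQd.sqrt (hQpos _).ne')).neg.deriv.trans ?_
    have hT : s₁ * (Real.sinh (τ x) / Real.cosh (τ x)) ^ 2 = s₁ - u x ^ 2 := by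
      rw [husq]
      have := Real.cosh_sq (τ x)
      field_simp
      linarith
    have hRsq : √(Q (τ x)) ^ 2 = 2 * c * s₁ * (s₂ - u x ^ 2) := by
      rw [Real.sq_sqrt (hQpos _).le, husq]
    have hK : (h (τ x))⁻¹ = √(Q (τ x)) / (a - 3 * u x ^ 2) := by
      rw [← hR]; field_simp [(hupos x).ne']
    have hR0 := (hRpos (τ x)).ne'
    have hu0 := (hupos x).ne'
    simp only [Pi.mul_apply]
    rw [hK]
    generalize √(Q (τ x)) = R at *
    generalize Real.sinh (τ x) / Real.cosh (τ x) = T at *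
    generalize u x = v at *
    trans -(v / (a - 3 * v ^ 2)) * ((1 - 2 * T ^ 2) * R ^ 2 + 2 * c * s₁ * T ^ 2 * v ^ 2)
    · field_simp
      ring
    rw [hRsq, neg_mul, div_mul_eq_mul_div, ← neg_div, div_eq_iff hu0]
    linear_combination v * (4 * c * s₂ - 6 * c * v ^ 2) * hT - 4 * v ^ 3 * hsum + 2 * v * hprod

/-- Band 2.1: existence of bright solitons for `g < 0` and `ω < min(ωX, ωC)`,
`γ² < ϖX·ϖC < (9/8)γ²`: even bounded envelopes vanishing at the far field, with the
stated attained peak value of `|g|·φX²`. -/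
theorem bright_soliton_band_2_1
    (ω ωX ωC γ g : ℝ) (hγ : γ ≠ 0) (hg : g < 0)
    (hω : ω < min ωX ωC)
    (hband₁ : γ ^ 2 < (ω - ωX) * (ω - ωC)) (hband₂ : (ω - ωX) * (ω - ωC) < (9/8) * γ ^ 2) :
    ∃ φX φC : ℝ → ℝ,
      ContDiff ℝ 1 φX ∧ ContDiff ℝ 2 φC ∧
      (∀ x : ℝ, (g * φX x ^ 2 - (ω - ωX)) * φX x + γ * φC x = 0) ∧
      (∀ x : ℝ, -(1/2) * deriv (deriv φC) x - (ω - ωC) * φC x + γ * φX x = 0) ∧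
      (∀ x : ℝ, φX (-x) = φX x) ∧ (∀ x : ℝ, φC (-x) = φC x) ∧
      (∃ M : ℝ, ∀ x : ℝ, |φX x| ≤ M) ∧ (∃ M : ℝ, ∀ x : ℝ, |φC x| ≤ M) ∧
      Tendsto φX atTop (nhds 0) ∧ Tendsto φX atBot (nhds 0) ∧
      Tendsto φC atTop (nhds 0) ∧ Tendsto φC atBot (nhds 0) ∧
      (∃ x₀ : ℝ, (∀ x : ℝ, |g| * φX x ^ 2 ≤ |g| * φX x₀ ^ 2) ∧
        |g| * φX x₀ ^ 2 = -(ω - ωX) + (γ ^ 2 / (ω - ωC)) *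
          (3/4 + Real.sqrt (9/16 - (ω - ωX) * (ω - ωC) / (2 * γ ^ 2)))) := by
  obtain ⟨hX, hC⟩ := lt_min_iff.1 hω
  set a : ℝ := ωX - ω with ha
  set c : ℝ := ωC - ω with hc
  have hX' : ω - ωX = -a := by rw [ha]; ring
  have hC' : ω - ωC = -c := by rw [hc]; ring
  have ha0 : 0 < a := sub_pos.2 hX
  have hc0 : 0 < c := sub_pos.2 hC
  rw [hX', hC', neg_mul_neg] at hband₁ hband₂ ⊢
  have hk : 0 < γ ^ 2 := by positivity
  set d := √(9 / 16 - a * c / (2 * γ ^ 2)) with hd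
  have hD : 0 < 9 / 16 - a * c / (2 * γ ^ 2) := by
    rw [sub_pos, div_lt_iff₀ (by positivity)]; linarith
  have hd0 : 0 < d := Real.sqrt_pos.2 hD
  have hdsq : 2 * γ ^ 2 * d ^ 2 = 9 / 8 * γ ^ 2 - a * c := by
    rw [hd, Real.sq_sqrt hD.le]; field_simp; ring
  have hd4 : d < 1 / 4 := by
    refine lt_of_pow_lt_pow_left₀ 2 (by norm_num) (lt_of_mul_lt_mul_left ?_ hk.le)
    linarith
  obtain ⟨u, huC, hue, hu0, hule, hutop, huode⟩ := exists_homoclinic (a := a) (c := c)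
    (k := γ ^ 2) (s₁ := a - γ ^ 2 / c * (3 / 4 + d)) (s₂ := a - γ ^ 2 / c * (3 / 4 - d)) hc0
    (by
      rw [sub_pos, div_mul_eq_mul_div, div_lt_iff₀ hc0]
      nlinarith)
    (by
      have : 0 < γ ^ 2 / c * d := by positivity
      linarith)
    (by
      have : 2 / 3 * a < γ ^ 2 / c * (3 / 4 + d) := by
        rw [div_mul_eq_mul_div (γ ^ 2), lt_div_iff₀ hc0]
        nlinarith
      linarith)
    (by field_simp; ring)
    (by field_simp; linear_combination -8 * γ ^ 2 * hdsq)
  have hg' : 0 < -g := neg_pos.2 hg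
  set q := √(-g) with hq
  have hq0 : q ≠ 0 := (Real.sqrt_pos.2 hg').ne'
  have hqsq : q ^ 2 = -g := Real.sq_sqrt hg'.le
  have habs : |g| = q ^ 2 := by rw [hqsq, abs_of_neg hg]
  have hgq : g = -q ^ 2 := by rw [hqsq, neg_neg]
  have hubot : Tendsto u atBot (nhds 0) := by
    simpa [Function.comp_def, hue] using hutop.comp tendsto_neg_atBot_atTop
  have hpeak : ∀ x, |g| * (q⁻¹ * u x) ^ 2 = u x ^ 2 := fun x => by
    rw [habs]
    field_simp
  have hub : ∀ x, |u x| ≤ |u 0| := fun x => sq_le_sq.1 ((hule x).trans_eq hu0.symm)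
  have hwC : ContDiff ℝ 2 fun x => (a - u x ^ 2) * u x :=
    (contDiff_const.sub (huC.pow 2)).mul huC
  have hwlim : ∀ l : Filter ℝ, Tendsto u l (nhds 0) →
      Tendsto (fun x => -(γ * q)⁻¹ * ((a - u x ^ 2) * u x)) l (nhds 0) := by
    intro l hl
    simpa using ((((hl.pow 2).const_sub a).mul hl).const_mul (-(γ * q)⁻¹))
  refine ⟨fun x => q⁻¹ * u x, fun x => -(γ * q)⁻¹ * ((a - u x ^ 2) * u x),
    contDiff_const.mul (huC.of_le (by norm_num)), contDiff_const.mul hwC, ?_, ?_, ?_, ?_, ?_, ?_,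
    by simpa using hutop.const_mul q⁻¹, by simpa using hubot.const_mul q⁻¹,
    hwlim _ hutop, hwlim _ hubot, 0, ?_, ?_⟩
  · intro x
    rw [hgq]
    field_simp
    ring
  · intro x
    simp only [deriv_const_mul_field', huode]
    field_simp
    ring
  · intro x; simp only [hue]
  · intro x; simp only [hue]
  · refine ⟨|q⁻¹| * |u 0|, fun x => ?_⟩
    rw [abs_mul]
    exact mul_le_mul_of_nonneg_left (hub x) (abs_nonneg _)
  · refine ⟨|-(γ * q)⁻¹| * ((|a| + |u 0| ^ 2) * |u 0|), fun x => ?_⟩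
    rw [abs_mul, abs_mul]
    have h1 : |a - u x ^ 2| ≤ |a| + |u 0| ^ 2 := by
      refine (abs_sub _ _).trans ?_
      rw [abs_pow]
      exact add_le_add_right (pow_le_pow_left₀ (abs_nonneg _) (hub x) 2) _
    exact mul_le_mul_of_nonneg_left
      (mul_le_mul h1 (hub x) (abs_nonneg _) (by positivity)) (abs_nonneg _)
  · intro x
    rw [hpeak, hpeak, hu0]
    exact hule x
  · rw [hpeak, hu0]
    field_simp
    ring
end
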